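/- Fix ε ∈ ℝ. The vector fields of the ε-family on ℝ⁷ satisfy, as equalities of maps ℝ⁷ → ℝ⁷: [ξ₁,ξ₅] = −3εξ₆, [ξ₃,ξ₅] = −3εξ₆, [ξ₂,ξ₅] = 0, [ξ₄,ξ₅] = 0, and [ξᵢ,ξ₆] = 0 and [ξᵢ,ξ₇] = 0 for all i ∈ {1,2,3,4}. -/

import Mathlib

/- The ε-family of hyperbolic (4,7)-distributions on ℝ⁷ with coordinates
(x, y, s, t, z, w, u), indexed by 0,…,6. Vector fields are identified with
maps ℝ⁷ → ℝ⁷ of their coefficients in the coordinate frame. -/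

def xi1 (ε : ℝ) (q : Fin 7 → ℝ) : Fin 7 → ℝ := ![1, 0, q 5 + ε * q 3, q 1, 0, 0, 0]
def xi2 (q : Fin 7 → ℝ) : Fin 7 → ℝ := ![0, 0, 0, 0, 1, 0, q 5]
def xi3 (ε : ℝ) (q : Fin 7 → ℝ) : Fin 7 → ℝ := ![0, 1, -(q 4 - ε * q 3), -q 0, 0, 0, 0]
def xi4 (q : Fin 7 → ℝ) : Fin 7 → ℝ := ![0, 0, 0, 0, 0, 1, -q 4]
def xi5 (ε : ℝ) (q : Fin 7 → ℝ) : Fin 7 → ℝ := ![0, 0, ε * (q 0 + q 1), -2, 0, 0, 0]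
def xi6 (_ : Fin 7 → ℝ) : Fin 7 → ℝ := ![0, 0, -1, 0, 0, 0, 0]
def xi7 (_ : Fin 7 → ℝ) : Fin 7 → ℝ := ![0, 0, 0, 0, 0, 0, -2]

theorem fderiv_apply_of_isLinearMap_sub_zero {E F : Type*} [NormedAddCommGroup E]
    [NormedSpace ℝ E] [FiniteDimensional ℝ E] [NormedAddCommGroup F] [NormedSpace ℝ F]
    {f : E → F} (hf : IsLinearMap ℝ fun q => f q - f 0) (p v : E) :
    fderiv ℝ f p v = f v - f 0 := by
  have h := ((hf.mk' _).toContinuousLinearMap.hasFDerivAt (x := p)).add_const (f 0)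
  have e : (fun q => (hf.mk' _).toContinuousLinearMap q + f 0) = f := by
    ext q; simp
  rw [e] at h
  simp [h.fderiv]

theorem lieBracket_of_isLinearMap_sub_zero {E : Type*} [NormedAddCommGroup E]
    [NormedSpace ℝ E] [FiniteDimensional ℝ E] {V W : E → E}
    (hV : IsLinearMap ℝ fun q => V q - V 0) (hW : IsLinearMap ℝ fun q => W q - W 0) :
    VectorField.lieBracket ℝ V W = fun p => (W (V p) - W 0) - (V (W p) - V 0) := by
  ext1 p
  rw [VectorField.lieBracket, fderiv_apply_of_isLinearMap_sub_zero hV,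
    fderiv_apply_of_isLinearMap_sub_zero hW]

theorem isLinearMap_xi1_sub_zero (ε : ℝ) : IsLinearMap ℝ fun q => xi1 ε q - xi1 ε 0 := by
  constructor <;> intros <;> ext i <;> fin_cases i <;> simp [xi1] <;> ring

theorem isLinearMap_xi2_sub_zero : IsLinearMap ℝ fun q => xi2 q - xi2 0 := by
  constructor <;> intros <;> ext i <;> fin_cases i <;> simp [xi2]

theorem isLinearMap_xi3_sub_zero (ε : ℝ) : IsLinearMap ℝ fun q => xi3 ε q - xi3 ε 0 := by
  constructor <;> intros <;> ext i <;> fin_cases i <;> simp [xi3] <;> ring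

theorem isLinearMap_xi4_sub_zero : IsLinearMap ℝ fun q => xi4 q - xi4 0 := by
  constructor <;> intros <;> ext i <;> fin_cases i <;> simp [xi4]
  ring

theorem isLinearMap_xi5_sub_zero (ε : ℝ) : IsLinearMap ℝ fun q => xi5 ε q - xi5 ε 0 := by
  constructor <;> intros <;> ext i <;> fin_cases i <;> simp [xi5] <;> ring

theorem isLinearMap_xi6_sub_zero : IsLinearMap ℝ fun q => xi6 q - xi6 0 := by
  constructor <;> intros <;> ext i <;> fin_cases i <;> simp [xi6]

theorem isLinearMap_xi7_sub_zero : IsLinearMap ℝ fun q => xi7 q - xi7 0 := by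
  constructor <;> intros <;> ext i <;> fin_cases i <;> simp [xi7]

/-- Higher bracket relations of the ε-family: [ξ₁,ξ₅] = −3εξ₆,
[ξ₃,ξ₅] = −3εξ₆, [ξ₂,ξ₅] = 0, [ξ₄,ξ₅] = 0, and [ξᵢ,ξ₆] = 0, [ξᵢ,ξ₇] = 0 for
all i ∈ {1,2,3,4}. -/
theorem epsilon_family_higher_brackets (ε : ℝ) :
    VectorField.lieBracket ℝ (xi1 ε) (xi5 ε) = (fun p => (-3 * ε) • xi6 p) ∧
    VectorField.lieBracket ℝ (xi3 ε) (xi5 ε) = (fun p => (-3 * ε) • xi6 p) ∧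
    VectorField.lieBracket ℝ xi2 (xi5 ε) = (fun _ => (0 : Fin 7 → ℝ)) ∧
    VectorField.lieBracket ℝ xi4 (xi5 ε) = (fun _ => (0 : Fin 7 → ℝ)) ∧
    (∀ i : Fin 4,
      VectorField.lieBracket ℝ (![xi1 ε, xi2, xi3 ε, xi4] i) xi6 =
        (fun _ => (0 : Fin 7 → ℝ)) ∧
      VectorField.lieBracket ℝ (![xi1 ε, xi2, xi3 ε, xi4] i) xi7 =
        (fun _ => (0 : Fin 7 → ℝ))) := by
  have h1 := isLinearMap_xi1_sub_zero ε
  have h2 := isLinearMap_xi2_sub_zero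
  have h3 := isLinearMap_xi3_sub_zero ε
  have h4 := isLinearMap_xi4_sub_zero
  have h5 := isLinearMap_xi5_sub_zero ε
  have h6 := isLinearMap_xi6_sub_zero
  have h7 := isLinearMap_xi7_sub_zero
  refine ⟨?_, ?_, ?_, ?_, fun i => ?_⟩
  · rw [lieBracket_of_isLinearMap_sub_zero h1 h5]
    ext p j
    fin_cases j <;> simp [xi1, xi5, xi6]
    ring
  · rw [lieBracket_of_isLinearMap_sub_zero h3 h5]
    ext p j
    fin_cases j <;> simp [xi3, xi5, xi6]
    ring
  · rw [lieBracket_of_isLinearMap_sub_zero h2 h5]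
    ext p j
    fin_cases j <;> simp [xi2, xi5]
  · rw [lieBracket_of_isLinearMap_sub_zero h4 h5]
    ext p j
    fin_cases j <;> simp [xi4, xi5]
  · have hi : IsLinearMap ℝ fun q => (![xi1 ε, xi2, xi3 ε, xi4] i) q -
        (![xi1 ε, xi2, xi3 ε, xi4] i) 0 := by
      fin_cases i <;> assumption
    rw [lieBracket_of_isLinearMap_sub_zero hi h6, lieBracket_of_isLinearMap_sub_zero hi h7]
    constructor <;> ext p j <;> fin_cases i <;> fin_cases j <;>
      simp [xi1, xi2, xi3, xi4, xi6, xi7]
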